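/- (Inverse closedness) Let (M_j)_{j≥0} be a weight sequence satisfying conditions (M2) and (M3), and let Ω ⊆ ℝⁿ be open. If f ∈ E_M(Ω) satisfies f(x) ≠ 0 for every x ∈ Ω, then the reciprocal 1/f belongs to E_M(Ω). -/

import Mathlib

open scoped Topology
open Filter

/-- `m_j = M_j / j!`. -/
noncomputable def mseq (M : ℕ → ℝ) (j : ℕ) : ℝ := M j / (Nat.factorial j : ℝ)

/-- A weight sequence: positive, normalized `M 0 = 1`, log-convex. -/
structure IsWeightSeq (M : ℕ → ℝ) : Prop where
  pos : ∀ j, 0 < M j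
  one : M 0 = 1
  logConvex : ∀ j : ℕ, 1 ≤ j → (M j) ^ 2 ≤ M (j - 1) * M (j + 1)

/-- Condition (M2): `sup_k (m_{k+1}/m_k)^(1/k) < ∞`. -/
def CondM2 (M : ℕ → ℝ) : Prop :=
  ∃ C : ℝ, ∀ k : ℕ, 1 ≤ k → (mseq M (k + 1) / mseq M k) ^ ((1 : ℝ) / k) ≤ C

/-- Condition (M3): log-convexity of `m_k`. -/
def CondM3 (M : ℕ → ℝ) : Prop :=
  ∀ k : ℕ, 1 ≤ k → (mseq M k) ^ 2 ≤ mseq M (k - 1) * mseq M (k + 1)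

/-- Condition (M4): `m_k^(1/k) → ∞`. -/
def CondM4 (M : ℕ → ℝ) : Prop :=
  Filter.Tendsto (fun k : ℕ => (mseq M k) ^ ((1 : ℝ) / k)) Filter.atTop Filter.atTop

/-- A regular weight sequence. -/
structure IsRegularWeightSeq (M : ℕ → ℝ) extends IsWeightSeq M : Prop where
  m_one : mseq M 1 = 1
  cond2 : CondM2 M
  cond3 : CondM3 M
  cond4 : CondM4 M

/-- The associated weight `h_M(t) = inf_k t^k m_k`. -/
noncomputable def weight_h (M : ℕ → ℝ) (t : ℝ) : ℝ := ⨅ k : ℕ, t ^ k * mseq M k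

/-- The associated weight function `ω_M(t) = sup_j log (t^j / M_j)`. -/
noncomputable def weight_omega (M : ℕ → ℝ) (t : ℝ) : ℝ := ⨆ j : ℕ, Real.log (t ^ j / M j)

/-- Membership in the Denjoy-Carleman class `E_M(Ω)`: smooth on `Ω` and on every
compact `K ⊆ Ω` the iterated derivatives satisfy `‖D^k f‖ ≤ C h^k M_k`. -/
def MemDC (M : ℕ → ℝ) {n : ℕ} {E : Type*} [NormedAddCommGroup E] [NormedSpace ℝ E]
    (Ω : Set (Fin n → ℝ)) (f : (Fin n → ℝ) → E) : Prop :=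
  ContDiffOn ℝ (⊤ : ℕ∞) f Ω ∧
  ∀ K : Set (Fin n → ℝ), K ⊆ Ω → IsCompact K →
    ∃ C > 0, ∃ h > 0, ∀ k : ℕ, ∀ x ∈ K,
      ‖iteratedFDerivWithin ℝ k f Ω x‖ ≤ C * h ^ k * M k

theorem mseq_pos {M : ℕ → ℝ} (hM : ∀ j, 0 < M j) (j : ℕ) : 0 < mseq M j :=
  div_pos (hM j) (by positivity)

theorem CondM3.monotone_ratio {M : ℕ → ℝ} (hM : ∀ j, 0 < M j) (h3 : CondM3 M) :
    Monotone fun k => mseq M (k + 1) / mseq M k := by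
  refine monotone_nat_of_le_succ fun k => ?_
  rw [div_le_div_iff₀ (mseq_pos hM k) (mseq_pos hM (k + 1))]
  have h := h3 (k + 1) (by omega)
  simp only [add_tsub_cancel_right] at h
  linarith

theorem CondM3.mseq_mul_le {M : ℕ → ℝ} (hM : IsWeightSeq M) (h3 : CondM3 M) (i j : ℕ) :
    mseq M i * mseq M j ≤ mseq M (i + j) := by
  induction i with
  | zero => simp [mseq, hM.one]
  | succ i ih =>
    have hi := mseq_pos hM.pos i
    have hij := mseq_pos hM.pos (i + j)
    calc mseq M (i + 1) * mseq M j
        = mseq M (i + 1) / mseq M i * (mseq M i * mseq M j) := by field_simp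
      _ ≤ mseq M (i + j + 1) / mseq M (i + j) * mseq M (i + j) :=
          mul_le_mul (h3.monotone_ratio hM.pos (Nat.le_add_right i j)) ih
            (mul_pos hi (mseq_pos hM.pos j)).le
            (div_pos (mseq_pos hM.pos _) hij).le
      _ = mseq M (i + 1 + j) := by
          rw [div_mul_cancel₀ _ hij.ne', add_right_comm]

theorem CondM3.choose_mul_le {M : ℕ → ℝ} (hM : IsWeightSeq M) (h3 : CondM3 M) (i j : ℕ) :
    ((i + j).choose i : ℝ) * (M i * M j) ≤ M (i + j) := by
  have h := h3.mseq_mul_le hM i j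
  simp only [mseq] at h
  rw [div_mul_div_comm, div_le_div_iff₀ (by positivity) (by positivity)] at h
  have hc : ((i + j).choose i : ℝ) * (i.factorial * j.factorial) = (i + j).factorial := by
    rw [← mul_assoc, Nat.choose_symm_add]
    exact_mod_cast Nat.add_choose_mul_factorial_mul_factorial i j
  rw [← hc] at h
  have hp : (0 : ℝ) < i.factorial * j.factorial := by positivity
  refine le_of_mul_le_mul_right ?_ hp
  linarith

/-- At a point where `f` does not vanish, the derivatives of `1/f` satisfy the recursive estimate
obtained from the Leibniz rule for `(f - f x) * f⁻¹`. -/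
theorem norm_iteratedFDerivWithin_inv_le {E : Type*} [NormedAddCommGroup E] [NormedSpace ℝ E]
    {s : Set E} {f : E → ℂ} (hf : ContDiffOn ℝ (⊤ : ℕ∞) f s) (hs : UniqueDiffOn ℝ s)
    (hnv : ∀ x ∈ s, f x ≠ 0) {x : E} (hx : x ∈ s) (k : ℕ) :
    ‖iteratedFDerivWithin ℝ (k + 1) (fun y => (f y)⁻¹) s x‖ ≤
      ‖(f x)⁻¹‖ * ∑ i ∈ Finset.range (k + 1), ((k + 1).choose (i + 1) : ℝ) *
        ‖iteratedFDerivWithin ℝ (i + 1) f s x‖ *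
        ‖iteratedFDerivWithin ℝ (k - i) (fun y => (f y)⁻¹) s x‖ := by
  have hu : ContDiffOn ℝ (⊤ : ℕ∞) (fun y => (f y)⁻¹) s := hf.inv hnv
  have hle (m : ℕ) : (m : WithTop ℕ∞) ≤ ((⊤ : ℕ∞) : WithTop ℕ∞) := by
    exact_mod_cast le_top
  have hsub (m : ℕ) : iteratedFDerivWithin ℝ (m + 1) (fun y => f y - f x) s x =
      iteratedFDerivWithin ℝ (m + 1) f s x := by
    rw [fun_iteratedFDerivWithin_sub_apply ((hf x hx).of_le (hle _)) contDiffWithinAt_const hs hx,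
      iteratedFDerivWithin_const_of_ne (Nat.succ_ne_zero m)]
    simp
  have hprod : iteratedFDerivWithin ℝ (k + 1) (fun y => (f y - f x) * (f y)⁻¹) s x =
      -(f x • iteratedFDerivWithin ℝ (k + 1) (fun y => (f y)⁻¹) s x) := by
    have hc : ContDiffWithinAt ℝ (k + 1 : ℕ) (f x • fun y => (f y)⁻¹) s x :=
      ((hu x hx).of_le (hle _)).const_smul (f x)
    rw [iteratedFDerivWithin_congr (f := fun y => (1 : ℂ) - (f x • fun y => (f y)⁻¹) y)
        (fun y hy => by simp [sub_mul, hnv y hy]) hx,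
      fun_iteratedFDerivWithin_sub_apply contDiffWithinAt_const hc hs hx,
      iteratedFDerivWithin_const_of_ne (Nat.succ_ne_zero k),
      iteratedFDerivWithin_const_smul_apply ((hu x hx).of_le (hle _)) hs hx]
    simp
  have hmul := norm_iteratedFDerivWithin_mul_le (hf.sub contDiffOn_const) hu hs hx (hle (k + 1))
    (f := fun y => f y - f x)
  rw [hprod, Finset.sum_range_succ'] at hmul
  simp only [hsub, norm_neg, norm_smul, norm_iteratedFDerivWithin_zero, sub_self, norm_zero,
    mul_zero, zero_mul, add_zero] at hmul
  calc _ = ‖(f x)⁻¹‖ * (‖f x‖ * ‖iteratedFDerivWithin ℝ (k + 1) (fun y => (f y)⁻¹) s x‖) := by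
        rw [← mul_assoc, ← norm_mul, inv_mul_cancel₀ (hnv x hx), norm_one, one_mul]
    _ ≤ _ := by
        refine mul_le_mul_of_nonneg_left (hmul.trans_eq (Finset.sum_congr rfl fun i _ => ?_))
          (norm_nonneg _)
        rw [Nat.add_sub_add_right]

theorem CondM3.norm_iteratedFDerivWithin_inv_le {M : ℕ → ℝ} (hM : IsWeightSeq M) (h3 : CondM3 M)
    {E : Type*} [NormedAddCommGroup E] [NormedSpace ℝ E]
    {s : Set E} {f : E → ℂ} (hf : ContDiffOn ℝ (⊤ : ℕ∞) f s) (hs : UniqueDiffOn ℝ s)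
    (hnv : ∀ x ∈ s, f x ≠ 0) {x : E} (hx : x ∈ s) {B C h : ℝ} (hC : 0 ≤ C) (hh : 0 ≤ h)
    (hB : ‖(f x)⁻¹‖ ≤ B) (hbound : ∀ k, ‖iteratedFDerivWithin ℝ k f s x‖ ≤ C * h ^ k * M k)
    (k : ℕ) :
    ‖iteratedFDerivWithin ℝ k (fun y => (f y)⁻¹) s x‖ ≤ B * (h * (1 + B * C)) ^ k * M k := by
  have hB0 : 0 ≤ B := (norm_nonneg _).trans hB
  set H := h * (1 + B * C) with hH
  have hH0 : 0 ≤ H := by positivity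
  have hhH : h ≤ H := le_mul_of_one_le_right hh (by linarith [mul_nonneg hB0 hC])
  induction k using Nat.strong_induction_on with
  | _ k ih =>
    cases k with
    | zero => simpa [hM.one] using hB
    | succ k =>
      have hterm : ∀ i ∈ Finset.range (k + 1), ((k + 1).choose (i + 1) : ℝ) *
          ‖iteratedFDerivWithin ℝ (i + 1) f s x‖ *
          ‖iteratedFDerivWithin ℝ (k - i) (fun y => (f y)⁻¹) s x‖ ≤
          C * B * h * M (k + 1) * (h ^ i * H ^ (k - i)) := by
        intro i hi
        have hik : i + 1 + (k - i) = k + 1 := by have := Finset.mem_range.1 hi; omega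
        have hch := h3.choose_mul_le hM (i + 1) (k - i)
        rw [hik] at hch
        have hMi := (hM.pos (i + 1)).le
        calc _ ≤ ((k + 1).choose (i + 1) : ℝ) * (C * h ^ (i + 1) * M (i + 1)) *
              (B * H ^ (k - i) * M (k - i)) := by
              gcongr
              · exact hbound _
              · exact ih _ (by omega)
          _ = C * B * h * (h ^ i * H ^ (k - i)) *
              (((k + 1).choose (i + 1) : ℝ) * (M (i + 1) * M (k - i))) := by ring
          _ ≤ C * B * h * (h ^ i * H ^ (k - i)) * M (k + 1) := by gcongr
          _ = _ := by ring
      have hgeom : B * C * h * ∑ i ∈ Finset.range (k + 1), h ^ i * H ^ (k - i) =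
          H ^ (k + 1) - h ^ (k + 1) := by
        have := (Commute.all h H).geom_sum₂_mul (k + 1)
        simp only [Nat.add_sub_cancel] at this
        have hd : B * C * h = H - h := by rw [hH]; ring
        rw [hd]
        linarith
      have hMk := (hM.pos (k + 1)).le
      calc _ ≤ _ := _root_.norm_iteratedFDerivWithin_inv_le hf hs hnv hx k
        _ ≤ B * ∑ i ∈ Finset.range (k + 1),
            C * B * h * M (k + 1) * (h ^ i * H ^ (k - i)) := by
            gcongr ?_ * ?_
            exact Finset.sum_le_sum hterm
        _ = B * M (k + 1) *
            (B * C * h * ∑ i ∈ Finset.range (k + 1), h ^ i * H ^ (k - i)) := by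
            rw [← Finset.mul_sum]; ring
        _ ≤ B * M (k + 1) * H ^ (k + 1) := by
            rw [hgeom]
            gcongr
            exact sub_le_self _ (by positivity)
        _ = _ := by ring

/-- Inverse closedness: a nonvanishing `f ∈ E_M(Ω)` has `1/f ∈ E_M(Ω)`. -/
theorem stmt_17 (M : ℕ → ℝ) (hM : IsWeightSeq M) (h2 : CondM2 M) (h3 : CondM3 M)
    {n : ℕ} (Ω : Set (Fin n → ℝ)) (hΩ : IsOpen Ω)
    (f : (Fin n → ℝ) → ℂ) (hf : MemDC M Ω f) (hnv : ∀ x ∈ Ω, f x ≠ 0) :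
    MemDC M Ω (fun x => (f x)⁻¹) := by
  have hu : ContDiffOn ℝ (⊤ : ℕ∞) (fun x => (f x)⁻¹) Ω := hf.1.inv hnv
  refine ⟨hu, fun K hK hKc => ?_⟩
  obtain ⟨C, hC, h, hh, hb⟩ := hf.2 K hK hKc
  obtain ⟨B, hB⟩ := hKc.exists_bound_of_continuousOn (hu.continuousOn.mono hK)
  have hB1 : 0 < max B 1 := lt_max_of_lt_right one_pos
  exact ⟨max B 1, hB1, h * (1 + max B 1 * C), by positivity, fun k x hx =>
    h3.norm_iteratedFDerivWithin_inv_le hM hf.1 hΩ.uniqueDiffOn hnv (hK hx) hC.le hh.le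
      ((hB x hx).trans (le_max_left _ _)) (fun k => hb k x hx) k⟩
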